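/- arXiv:2310.11526 — 2 statements merged into one kernel-verified Lean document; each statement's English description precedes it below -/
import Mathlib

section
/- There exists N such that for all n ≥ N the following holds. Let X be a distribution on {0,1}^n and x* ∈ {0,1}^n such that (i) X(x*) ≥ 1/(6n), and (ii) X(x') ≤ 2/n^600 for every x' ≠ x*. Let A₀ be the distribution of the pair (r, ⟨x,r⟩) with r ← U_n and x ← X sampled independently, and let A₁ be the distribution of the pair (r, b) where r ← U_n, x ← X are independent and b is a uniform bit independent of r if x = x*, while b = ⟨x,r⟩ otherwise. Then H(A₁) − H(A₀) ≥ 1/(100 n²). -/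
/-- The base-2 Shannon entropy of a distribution `P` on a finite set,
with the convention `0 * log₂ 0 = 0` (note `Real.logb 2 0 = 0`). -/
noncomputable def shannonH {S : Type*} [Fintype S] (P : S → ℝ) : ℝ :=
  ∑ x, -(P x * Real.logb 2 (P x))

/-- `P` is a probability distribution on the finite set `S`. -/
def IsDist {S : Type*} [Fintype S] (P : S → ℝ) : Prop :=
  (∀ x, 0 ≤ P x) ∧ (∑ x, P x) = 1

/-- Boolean inner product of two length-`n` bit strings. -/
def ip {n : ℕ} (x r : Fin n → ZMod 2) : ZMod 2 := ∑ i, x i * r i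

/-- The sign character `b ↦ (-1)^b` of a bit. -/
noncomputable def bitSign (b : ZMod 2) : ℝ := if b = 0 then 1 else -1

theorem bitSign_add (a b : ZMod 2) : bitSign (a + b) = bitSign a * bitSign b := by
  have h1 : (1 : ZMod 2) + 1 = 0 := by decide
  have h01 : ∀ c : ZMod 2, c = 0 ∨ c = 1 := by decide
  rcases h01 a with rfl | rfl <;> rcases h01 b with rfl | rfl <;> simp [bitSign, h1]

theorem abs_bitSign (b : ZMod 2) : |bitSign b| = 1 := by
  unfold bitSign; split_ifs <;> simp

theorem ite_eq_bitSign (a b : ZMod 2) :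
    (if a = b then (1 : ℝ) else 0) = (1 + bitSign b * bitSign a) / 2 := by
  have h01 : ∀ c : ZMod 2, c = 0 ∨ c = 1 := by decide
  rcases h01 a with rfl | rfl <;> rcases h01 b with rfl | rfl <;> norm_num [bitSign]

theorem ip_add_left {n : ℕ} (x y r : Fin n → ZMod 2) : ip (x + y) r = ip x r + ip y r := by
  simp [ip, add_mul, Finset.sum_add_distrib]

theorem ip_add_right {n : ℕ} (x r s : Fin n → ZMod 2) : ip x (r + s) = ip x r + ip x s := by
  simp [ip, mul_add, Finset.sum_add_distrib]

theorem sum_bitSign_ip {n : ℕ} {z : Fin n → ZMod 2} (hz : z ≠ 0) :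
    ∑ r, bitSign (ip z r) = 0 := by
  obtain ⟨i, hi⟩ := Function.ne_iff.mp hz
  have hshift : ∀ r, bitSign (ip z (r + Pi.single i 1)) = -bitSign (ip z r) := by
    intro r
    have : ip z (Pi.single i 1) = z i := by simp [ip, Pi.single_apply]
    rw [ip_add_right, bitSign_add, this]
    have : bitSign (z i) = -1 := if_neg hi
    rw [this]; ring
  have h := Equiv.sum_comp (Equiv.addRight (Pi.single i (1 : ZMod 2)))
    (fun r => bitSign (ip z r))
  simp only [Equiv.coe_addRight, hshift, Finset.sum_neg_distrib] at h
  linarith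

theorem sum_bitSign_ip_mul {n : ℕ} (x y : Fin n → ZMod 2) :
    ∑ r, bitSign (ip x r) * bitSign (ip y r) = if x = y then (2 : ℝ) ^ n else 0 := by
  simp only [← bitSign_add, ← ip_add_left]
  split_ifs with h
  · subst h
    have : x + x = 0 := by ext i; exact CharTwo.add_self_eq_zero (x i)
    rw [this]
    simp [ip, bitSign]
  · refine sum_bitSign_ip fun h0 => h ?_
    ext i
    exact CharTwo.add_eq_zero.mp (congrFun h0 i)

/-- The Walsh–Hadamard transform of `Y`. -/
noncomputable def walsh {n : ℕ} (Y : (Fin n → ZMod 2) → ℝ) (r : Fin n → ZMod 2) : ℝ :=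
  ∑ x, Y x * bitSign (ip x r)

theorem sum_walsh_sq {n : ℕ} (Y : (Fin n → ZMod 2) → ℝ) :
    ∑ r, walsh Y r ^ 2 = 2 ^ n * ∑ x, Y x ^ 2 := by
  calc ∑ r, walsh Y r ^ 2
      = ∑ r, ∑ x, ∑ y, Y x * Y y * (bitSign (ip x r) * bitSign (ip y r)) := by
        refine Finset.sum_congr rfl fun r _ => ?_
        rw [walsh, sq, Finset.sum_mul_sum]
        exact Finset.sum_congr rfl fun x _ => Finset.sum_congr rfl fun y _ => by ring
    _ = ∑ x, ∑ y, Y x * Y y * ∑ r, bitSign (ip x r) * bitSign (ip y r) := by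
        rw [Finset.sum_comm]
        refine Finset.sum_congr rfl fun x _ => ?_
        rw [Finset.sum_comm]
        exact Finset.sum_congr rfl fun y _ => by rw [Finset.mul_sum]
    _ = 2 ^ n * ∑ x, Y x ^ 2 := by
        simp only [sum_bitSign_ip_mul, mul_ite, mul_zero, Finset.sum_ite_eq, Finset.mem_univ,
          if_true, Finset.mul_sum]
        exact Finset.sum_congr rfl fun x _ => by ring

theorem abs_walsh_le {n : ℕ} (Y : (Fin n → ZMod 2) → ℝ) (r : Fin n → ZMod 2) :
    |walsh Y r| ≤ ∑ x, |Y x| := by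
  refine (Finset.abs_sum_le_sum_abs _ _).trans_eq ?_
  simp [abs_mul, abs_bitSign]

theorem mul_log_le_sq_sub_self {u : ℝ} (hu : 0 ≤ u) : u * Real.log u ≤ u ^ 2 - u := by
  rcases hu.eq_or_lt with rfl | hu
  · simp
  · nlinarith [Real.log_le_sub_one_of_pos hu]

theorem sq_sub_one_div_two_le_mul_log {u : ℝ} (hu : 0 ≤ u) (hu1 : u ≤ 1) :
    (u ^ 2 - 1) / 2 ≤ u * Real.log u := by
  rcases hu.eq_or_lt with rfl | hu
  · norm_num
  · have h : Real.sinh (Real.log u) ≤ Real.log u :=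
      Real.sinh_le_self_iff.mpr (Real.log_nonpos hu.le hu1)
    rw [Real.sinh_log hu] at h
    have := mul_le_mul_of_nonneg_left h hu.le
    have h2 : u * ((u - u⁻¹) / 2) = (u ^ 2 - 1) / 2 := by field_simp
    linarith

theorem mul_log_add_mul_log_le {t : ℝ} (ht : |t| ≤ 1) :
    (1 + t) * Real.log (1 + t) + (1 - t) * Real.log (1 - t) ≤ 2 * t ^ 2 := by
  obtain ⟨h1, h2⟩ := abs_le.mp ht
  have := mul_log_le_sq_sub_self (u := 1 + t) (by linarith)
  have := mul_log_le_sq_sub_self (u := 1 - t) (by linarith)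
  nlinarith

theorem le_mul_log_add_mul_log {t : ℝ} (ht : |t| ≤ 1) :
    5 / 6 * t ^ 2 ≤ (1 + t) * Real.log (1 + t) + (1 - t) * Real.log (1 - t) := by
  wlog h0 : 0 ≤ t generalizing t
  · have := this (t := -t) (by rwa [abs_neg]) (by linarith)
    simp only [sub_neg_eq_add, ← sub_eq_add_neg, neg_sq] at this
    linarith
  have h1 : t ≤ 1 := (abs_le.mp ht).2
  have hm := sq_sub_one_div_two_le_mul_log (u := 1 - t) (by linarith) (by linarith)
  have hp := mul_le_mul_of_nonneg_left (Real.le_log_one_add_of_nonneg h0)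
    (by linarith : 0 ≤ 1 + t)
  have : t + t ^ 2 / 3 ≤ (1 + t) * (2 * t / (t + 2)) := by
    rw [← mul_div_assoc, le_div_iff₀ (by linarith)]
    nlinarith [mul_nonneg (sq_nonneg t) (sub_nonneg.mpr h1)]
  nlinarith

theorem shannonH_of_bias {n : ℕ} (t : (Fin n → ZMod 2) → ℝ) :
    shannonH (fun p : (Fin n → ZMod 2) × ZMod 2 =>
        (1 / 2 ^ n) * ((1 + bitSign p.2 * t p.1) / 2))
      = n + 1 - (∑ r, ((1 + t r) * Real.log (1 + t r) + (1 - t r) * Real.log (1 - t r)))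
          / (2 * 2 ^ n * Real.log 2) := by
  have hl : Real.log 2 ≠ 0 := (Real.log_pos one_lt_two).ne'
  have key : ∀ u : ℝ, -((1 / 2 ^ n) * (u / 2) * Real.logb 2 ((1 / 2 ^ n) * (u / 2)))
      = (n + 1) / (2 * 2 ^ n) * u - u * Real.log u / (2 * 2 ^ n * Real.log 2) := by
    intro u
    rcases eq_or_ne u 0 with rfl | hu
    · simp
    · rw [Real.logb, Real.log_mul (by positivity) (by positivity), Real.log_div hu two_ne_zero,
        Real.log_div one_ne_zero (by positivity), Real.log_pow, Real.log_one]
      field_simp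
      ring
  have hsum : ∀ f : ZMod 2 → ℝ, ∑ b, f b = f 0 + f 1 := Fin.sum_univ_two
  unfold shannonH
  simp only [key, Fintype.sum_prod_type, hsum]
  have h0 : bitSign 0 = 1 := if_pos rfl
  have h1 : bitSign 1 = -1 := if_neg one_ne_zero
  simp only [h0, h1, one_mul, neg_mul, ← sub_eq_add_neg]
  have hr : ∀ r, (n + 1) / (2 * 2 ^ n) * (1 + t r)
        - (1 + t r) * Real.log (1 + t r) / (2 * 2 ^ n * Real.log 2)
        + ((n + 1) / (2 * 2 ^ n) * (1 - t r)
          - (1 - t r) * Real.log (1 - t r) / (2 * 2 ^ n * Real.log 2))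
      = (n + 1) / 2 ^ n - ((1 + t r) * Real.log (1 + t r) + (1 - t r) * Real.log (1 - t r))
          / (2 * 2 ^ n * Real.log 2) := by
    intro r
    field_simp
    ring
  simp only [hr, Finset.sum_sub_distrib, ← Finset.sum_div]
  congr 1
  simp
  field_simp

theorem le_shannonH_of_walsh {n : ℕ} {Y : (Fin n → ZMod 2) → ℝ} (hY : ∑ x, |Y x| ≤ 1) :
    n + 1 - (∑ x, Y x ^ 2) / Real.log 2 ≤
      shannonH (fun p : (Fin n → ZMod 2) × ZMod 2 =>
        (1 / 2 ^ n) * ((1 + bitSign p.2 * walsh Y p.1) / 2)) := by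
  have ht : ∀ r, |walsh Y r| ≤ 1 := fun r => (abs_walsh_le Y r).trans hY
  have hl : 0 < Real.log 2 := Real.log_pos one_lt_two
  rw [shannonH_of_bias]
  have h := Finset.sum_le_sum fun r (_ : r ∈ Finset.univ) => mul_log_add_mul_log_le (ht r)
  rw [← Finset.mul_sum, sum_walsh_sq] at h
  refine sub_le_sub_left ?_ _
  rw [div_le_div_iff₀ (by positivity) hl]
  nlinarith

theorem shannonH_walsh_le {n : ℕ} {Y : (Fin n → ZMod 2) → ℝ} (hY : ∑ x, |Y x| ≤ 1) :
    shannonH (fun p : (Fin n → ZMod 2) × ZMod 2 =>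
        (1 / 2 ^ n) * ((1 + bitSign p.2 * walsh Y p.1) / 2))
      ≤ n + 1 - (5 / 12 * ∑ x, Y x ^ 2) / Real.log 2 := by
  have ht : ∀ r, |walsh Y r| ≤ 1 := fun r => (abs_walsh_le Y r).trans hY
  have hl : 0 < Real.log 2 := Real.log_pos one_lt_two
  rw [shannonH_of_bias]
  have h := Finset.sum_le_sum fun r (_ : r ∈ Finset.univ) => le_mul_log_add_mul_log (ht r)
  rw [← Finset.mul_sum, sum_walsh_sq] at h
  refine sub_le_sub_left ?_ _
  rw [div_le_div_iff₀ hl (by positivity)]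
  nlinarith

theorem sum_ite_ip_eq {n : ℕ} {X : (Fin n → ZMod 2) → ℝ} (hX : ∑ x, X x = 1)
    (r : Fin n → ZMod 2) (b : ZMod 2) :
    (∑ x, if ip x r = b then X x else 0) = (1 + bitSign b * walsh X r) / 2 := by
  rw [walsh, ← hX, Finset.mul_sum, ← Finset.sum_add_distrib, Finset.sum_div]
  refine Finset.sum_congr rfl fun x _ => ?_
  have := ite_eq_bitSign (ip x r) b
  rw [← mul_boole, this]
  ring

theorem half_add_sum_ite_ip_eq {n : ℕ} {X : (Fin n → ZMod 2) → ℝ} (hX : ∑ x, X x = 1)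
    (xs r : Fin n → ZMod 2) (b : ZMod 2) :
    (X xs / 2 + ∑ x, if x ≠ xs ∧ ip x r = b then X x else 0)
      = (1 + bitSign b * walsh (fun x => if x = xs then 0 else X x) r) / 2 := by
  have hs : X xs / 2 = ∑ x, if x = xs then X x / 2 else 0 := by simp
  rw [hs, walsh, ← hX, Finset.mul_sum, ← Finset.sum_add_distrib, ← Finset.sum_add_distrib,
    Finset.sum_div]
  refine Finset.sum_congr rfl fun x _ => ?_
  by_cases h : x = xs
  · simp [h]
  · have := ite_eq_bitSign (ip x r) b
    simp only [h, if_false, ne_eq, not_false_eq_true, true_and, zero_add]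
    rw [← mul_boole, this]
    ring

/- `A₀` is the distribution of `(r, ⟨x,r⟩)` for independent `r ← U_n`, `x ← X`;
`A₁` is the distribution of `(r, b)` where `b` is a uniform independent bit if `x = x*`
and `b = ⟨x,r⟩` otherwise. -/
theorem stmt4 :
    ∃ N : ℕ, ∀ n : ℕ, N ≤ n →
      ∀ X : (Fin n → ZMod 2) → ℝ, IsDist X →
      ∀ xs : Fin n → ZMod 2,
        1 / (6 * (n : ℝ)) ≤ X xs →
        (∀ x', x' ≠ xs → X x' ≤ 2 / (n : ℝ) ^ 600) →
        shannonH (fun p : (Fin n → ZMod 2) × ZMod 2 =>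
              (1 / 2 ^ n) * (X xs / 2 + ∑ x, if x ≠ xs ∧ ip x p.1 = p.2 then X x else 0))
          - shannonH (fun p : (Fin n → ZMod 2) × ZMod 2 =>
              (1 / 2 ^ n) * ∑ x, if ip x p.1 = p.2 then X x else 0)
          ≥ 1 / (100 * (n : ℝ) ^ 2) := by
  refine ⟨2, fun n hn X hX xs ha hS => ?_⟩
  obtain ⟨hX0, hX1⟩ := hX
  simp only [half_add_sum_ite_ip_eq hX1, sum_ite_ip_eq hX1]
  set Y : (Fin n → ZMod 2) → ℝ := fun x => if x = xs then 0 else X x with hY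
  have hYX : ∀ x, 0 ≤ Y x ∧ Y x ≤ X x ∧ Y x ≤ 2 / (n : ℝ) ^ 600 := by
    intro x
    by_cases h : x = xs
    · simp only [hY, h, if_true]
      exact ⟨le_rfl, hX0 xs, by positivity⟩
    · simp only [hY, h, if_false]
      exact ⟨hX0 x, le_rfl, hS x h⟩
  have hYsum : ∑ x, |Y x| ≤ 1 := by
    rw [← hX1]
    exact Finset.sum_le_sum fun x _ => (abs_of_nonneg (hYX x).1).trans_le (hYX x).2.1
  have hXsum : ∑ x, |X x| ≤ 1 := by
    rw [← hX1]
    exact Finset.sum_le_sum fun x _ => (abs_of_nonneg (hX0 x)).le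
  have hYsq : ∑ x, Y x ^ 2 ≤ 2 / (n : ℝ) ^ 600 := by
    calc ∑ x, Y x ^ 2 ≤ ∑ x, 2 / (n : ℝ) ^ 600 * X x := by
          refine Finset.sum_le_sum fun x _ => ?_
          rw [sq]
          exact mul_le_mul (hYX x).2.2 (hYX x).2.1 (hYX x).1 (by positivity)
      _ = 2 / (n : ℝ) ^ 600 := by rw [← Finset.mul_sum, hX1, mul_one]
  have hXsq : X xs ^ 2 ≤ ∑ x, X x ^ 2 :=
    Finset.single_le_sum (f := fun x => X x ^ 2) (fun x _ => sq_nonneg _) (Finset.mem_univ xs)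
  have hn' : (2 : ℝ) ≤ n := by exact_mod_cast hn
  have hlow := le_shannonH_of_walsh hYsum
  have hupp := shannonH_walsh_le hXsum
  have hl : 0 < Real.log 2 := Real.log_pos one_lt_two
  have hl1 : Real.log 2 ≤ 1 := by linarith [Real.log_two_lt_d9]
  have htiny : 2 / (n : ℝ) ^ 600 ≤ 1 / 1024 * (1 / (n : ℝ) ^ 2) := by
    have h13 : (n : ℝ) ^ 13 ≤ (n : ℝ) ^ 600 := pow_le_pow_right₀ (by linarith) (by norm_num)
    have h11 : (2 : ℝ) ^ 11 ≤ (n : ℝ) ^ 11 := by gcongr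
    calc 2 / (n : ℝ) ^ 600 ≤ 2 / (n : ℝ) ^ 13 := by gcongr
      _ = 2 / ((n : ℝ) ^ 11 * (n : ℝ) ^ 2) := by rw [← pow_add]
      _ ≤ 2 / (2 ^ 11 * (n : ℝ) ^ 2) := by gcongr
      _ = 1 / 1024 * (1 / (n : ℝ) ^ 2) := by field_simp; norm_num
  have hasq : 1 / 36 * (1 / (n : ℝ) ^ 2) ≤ X xs ^ 2 := by
    calc 1 / 36 * (1 / (n : ℝ) ^ 2) = (1 / (6 * (n : ℝ))) ^ 2 := by field_simp; norm_num
      _ ≤ X xs ^ 2 := by gcongr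
  have hpos : 0 < 1 / (n : ℝ) ^ 2 := by positivity
  have hgoal : 1 / (100 * (n : ℝ) ^ 2) = 1 / 100 * (1 / (n : ℝ) ^ 2) := by field_simp
  have hdiff : 1 / 100 * (1 / (n : ℝ) ^ 2) ≤ 5 / 12 * ∑ x, X x ^ 2 - ∑ x, Y x ^ 2 := by
    linarith
  have hdiv : 5 / 12 * ∑ x, X x ^ 2 - ∑ x, Y x ^ 2
      ≤ (5 / 12 * ∑ x, X x ^ 2 - ∑ x, Y x ^ 2) / Real.log 2 :=
    le_div_self (by linarith) hl hl1
  rw [sub_div] at hdiv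
  rw [hgoal]
  linarith
end

section
/- There exists N such that for all n ≥ N the following holds. Let K be a distribution on {0,1}^n and j an integer; set G := {k : 2^{−(j+1)} ≤ K(k) ≤ 2^{−j}} and A := {k : K(k) ≥ 2^{−j}·n^{−500}}. Let Y be a finite set, f : {0,1}^n → Y a function, and y ∈ Y with Pr_{k←K}[f(k) = y] > 0 such that Pr_{k←K}[ k ∈ G | f(k) = y ] ≥ 1/(6n) and at most one k ∈ A satisfies f(k) = y. Let K_y denote K conditioned on the event {k : f(k) = y}. Let (R, Q) be the distribution of the pair (r, ⟨k,r⟩) with r ← U_n and k ← K_y sampled independently, and let (R, P) be the distribution of (r, b) where r ← U_n, k ← K_y are independent and b is a uniform bit independent of r if k ∈ G, while b = ⟨k,r⟩ otherwise. Then H(R, P) − H(R, Q) ≥ 1/(100 n²). -/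
/-- `K` conditioned on the event `{k : f k = y}`. -/
noncomputable def condDist {S : Type*} [Fintype S] {Y : Type*} [DecidableEq Y]
    (K : S → ℝ) (f : S → Y) (y : Y) (k : S) : ℝ :=
  (if f k = y then K k else 0) / (∑ k', if f k' = y then K k' else 0)

/-- The nontrivial sign character `ZMod 2 → {1, -1}`. -/
def zmodTwoSign (a : ZMod 2) : ℝ := if a = 0 then 1 else -1

lemma zmodTwoSign_add (a b : ZMod 2) :
    zmodTwoSign (a + b) = zmodTwoSign a * zmodTwoSign b := by
  have h : ∀ a b : ZMod 2, (a + b = 0 ↔ (a = 0 ↔ b = 0)) := by decide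
  unfold zmodTwoSign
  rw [if_congr (h a b) rfl rfl]
  by_cases ha : a = 0 <;> by_cases hb : b = 0 <;> simp [ha, hb]

/-- The Walsh character `r ↦ (-1)^⟨k,r⟩`. -/
def walshChar {n : ℕ} (k : Fin n → ZMod 2) : AddChar (Fin n → ZMod 2) ℝ where
  toFun r := zmodTwoSign (ip k r)
  map_zero_eq_one' := by simp [ip, zmodTwoSign]
  map_add_eq_mul' a b := by
    rw [← zmodTwoSign_add]
    simp [ip, mul_add, Finset.sum_add_distrib]

lemma walshChar_apply {n : ℕ} (k r : Fin n → ZMod 2) :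
    walshChar k r = zmodTwoSign (ip k r) := rfl

lemma walshChar_add {n : ℕ} (k l : Fin n → ZMod 2) :
    walshChar (k + l) = walshChar k * walshChar l := by
  ext r
  simp [walshChar_apply, ← zmodTwoSign_add, ip, add_mul, Finset.sum_add_distrib]

lemma walshChar_eq_zero_iff {n : ℕ} (k : Fin n → ZMod 2) : walshChar k = 0 ↔ k = 0 := by
  constructor
  · intro h
    ext i
    have hi := DFunLike.congr_fun h (Pi.single i 1)
    by_contra hk
    simp only [Pi.zero_apply] at hk
    simp [walshChar_apply, ip, Pi.single_apply, zmodTwoSign, hk] at hi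
    norm_num at hi
  · rintro rfl
    ext r
    simp [walshChar_apply, ip, zmodTwoSign]

lemma sum_walshChar_mul {n : ℕ} (k l : Fin n → ZMod 2) :
    ∑ r, walshChar k r * walshChar l r = if k = l then (2 : ℝ) ^ n else 0 := by
  classical
  have h := AddChar.sum_eq_ite (walshChar (k + l))
  have hkl : k + l = 0 ↔ k = l := by
    rw [add_eq_zero_iff_eq_neg, show -l = l from funext fun i => ZMod.neg_eq_self_mod_two (l i)]
  simp only [walshChar_eq_zero_iff, hkl] at h
  simpa [walshChar_add] using h

/-- Parseval's identity for the Walsh transform. -/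
lemma sum_sq_walsh {n : ℕ} (w : (Fin n → ZMod 2) → ℝ) :
    ∑ r, (∑ k, w k * walshChar k r) ^ 2 = 2 ^ n * ∑ k, w k ^ 2 := by
  calc ∑ r, (∑ k, w k * walshChar k r) ^ 2
      = ∑ r, ∑ k, ∑ l, w k * w l * (walshChar k r * walshChar l r) := by
        refine Finset.sum_congr rfl fun r _ => ?_
        rw [sq, Finset.sum_mul_sum]
        exact Finset.sum_congr rfl fun k _ => Finset.sum_congr rfl fun l _ => by ring
    _ = ∑ k, ∑ l, w k * w l * ∑ r, walshChar k r * walshChar l r := by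
        rw [Finset.sum_comm]
        refine Finset.sum_congr rfl fun k _ => ?_
        rw [Finset.sum_comm]
        simp only [Finset.mul_sum]
    _ = _ := by
        simp only [sum_walshChar_mul, mul_ite, mul_zero, Finset.sum_ite_eq, Finset.mem_univ,
          if_true, Finset.mul_sum]
        exact Finset.sum_congr rfl fun k _ => by ring

lemma sum_ip_eq_add {n : ℕ} (w : (Fin n → ZMod 2) → ℝ) (r : Fin n → ZMod 2) :
    (∑ k, if ip k r = 0 then w k else 0) + (∑ k, if ip k r = 1 then w k else 0) = ∑ k, w k := by
  have h : ∀ a : ZMod 2, a = 1 ↔ ¬ a = 0 := by decide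
  rw [← Finset.sum_add_distrib]
  refine Finset.sum_congr rfl fun k _ => ?_
  by_cases hk : ip k r = 0 <;> simp [h, hk]

lemma sum_ip_eq_sub {n : ℕ} (w : (Fin n → ZMod 2) → ℝ) (r : Fin n → ZMod 2) :
    (∑ k, if ip k r = 0 then w k else 0) - (∑ k, if ip k r = 1 then w k else 0)
      = ∑ k, w k * walshChar k r := by
  have h : ∀ a : ZMod 2, a = 1 ↔ ¬ a = 0 := by decide
  rw [← Finset.sum_sub_distrib]
  refine Finset.sum_congr rfl fun k _ => ?_
  by_cases hk : ip k r = 0 <;> simp [h, hk, walshChar_apply, zmodTwoSign]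

/-- Pinsker's inequality for a bit of bias `e`, in nats. -/
lemma sq_le_mul_log_add_mul_log_of_nonneg {e : ℝ} (h0 : 0 ≤ e) (h1 : e ≤ 1) :
    e ^ 2 ≤ (1 + e) * Real.log (1 + e) + (1 - e) * Real.log (1 - e) := by
  let F : ℝ → ℝ := fun e => (1 + e) * Real.log (1 + e) + (1 - e) * Real.log (1 - e) - e ^ 2
  have hmono : MonotoneOn F (Set.Icc 0 1) := by
    refine monotoneOn_of_hasDerivWithinAt_nonneg
      (f' := fun x => Real.log (1 + x) - Real.log (1 - x) - 2 * x) (convex_Icc 0 1) ?_ ?_ ?_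
    · refine Continuous.continuousOn ?_
      exact ((Real.continuous_mul_log.comp (continuous_const.add continuous_id)).add
        (Real.continuous_mul_log.comp (continuous_const.sub continuous_id))).sub
        (continuous_id.pow 2)
    · intro x hx
      rw [interior_Icc] at hx
      refine HasDerivAt.hasDerivWithinAt ?_
      have ha : HasDerivAt (fun x : ℝ => 1 + x) 1 x := (hasDerivAt_id x).const_add 1
      have hb : HasDerivAt (fun x : ℝ => 1 - x) (-1) x := (hasDerivAt_id x).const_sub 1
      have hA := (Real.hasDerivAt_mul_log (x := 1 + x) (by linarith [hx.1])).comp x ha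
      have hB := (Real.hasDerivAt_mul_log (x := 1 - x) (by linarith [hx.2])).comp x hb
      have := (hA.add hB).sub ((hasDerivAt_id x).pow 2)
      refine this.congr_deriv ?_
      simp
      ring
    · intro x hx
      rw [interior_Icc] at hx
      have h := Real.hasSum_log_sub_log_of_abs_lt_one (x := x)
        (abs_lt.2 ⟨by linarith [hx.1], hx.2⟩)
      have h' := h.summable.sum_le_tsum {0} fun i _ => by have := hx.1; positivity
      rw [h.tsum_eq] at h'
      simp at h'
      linarith
  have := hmono ⟨le_rfl, zero_le_one⟩ ⟨h0, h1⟩ h0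
  simp [F] at this
  linarith

lemma mul_log_add_mul_log_bounds {x y : ℝ} (hx : 0 ≤ x) (hy : 0 ≤ y) (hxy : x + y = 1) :
    (x - y) ^ 2 / 2 ≤ x * Real.log x + y * Real.log y + Real.log 2 ∧
      x * Real.log x + y * Real.log y + Real.log 2 ≤ (x - y) ^ 2 := by
  have hlog : ∀ z : ℝ, z * Real.log (2 * z) = z * Real.log 2 + z * Real.log z := by
    intro z
    rcases eq_or_ne z 0 with rfl | hz
    · simp
    · rw [Real.log_mul two_ne_zero hz]; ring
  have hle : ∀ z : ℝ, 0 ≤ z → z * Real.log (2 * z) ≤ z * (2 * z - 1) := by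
    intro z hz
    rcases hz.eq_or_lt with rfl | hz
    · simp
    · exact mul_le_mul_of_nonneg_left (Real.log_le_sub_one_of_pos (by positivity)) hz.le
  have hsum : x * Real.log x + y * Real.log y + Real.log 2
      = x * Real.log (2 * x) + y * Real.log (2 * y) := by
    rw [hlog, hlog]
    linear_combination (-Real.log 2) * hxy
  have key : ∀ x y : ℝ, 0 ≤ y → x + y = 1 → y ≤ x →
      (x - y) ^ 2 / 2 ≤ x * Real.log (2 * x) + y * Real.log (2 * y) := by
    intro x y hy hxy hyx
    have h := sq_le_mul_log_add_mul_log_of_nonneg (e := x - y) (by linarith) (by linarith)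
    rw [show 1 + (x - y) = 2 * x by linarith, show 1 - (x - y) = 2 * y by linarith] at h
    linarith
  rw [hsum]
  constructor
  · rcases le_total y x with h | h
    · exact key x y hy hxy h
    · have := key y x hx (by linarith) h
      nlinarith
  · have h1 := hle x hx
    have h2 := hle y hy
    have hy' : y = 1 - x := by linarith
    subst hy'
    nlinarith

/-- The entropy of a pair `(r, b)` with `r` uniform on `α` and `b` a bit of law `q (r, ·)`. -/
lemma shannonH_uniform_pair {α : Type*} [Fintype α] {M : ℝ} (hM : 0 < M)
    (hcard : (Fintype.card α : ℝ) = M) (q : α × ZMod 2 → ℝ) (hq : ∀ r, q (r, 0) + q (r, 1) = 1) :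
    Real.log 2 * shannonH (fun p => (1 / M) * q p) = Real.log M + Real.log 2
      - (1 / M) * ∑ r, (q (r, 0) * Real.log (q (r, 0)) + q (r, 1) * Real.log (q (r, 1))
          + Real.log 2) := by
  have hL : Real.log 2 ≠ 0 := (Real.log_pos one_lt_two).ne'
  have hterm : ∀ z : ℝ, Real.log 2 * -((1 / M) * z * Real.logb 2 ((1 / M) * z))
      = (1 / M) * (z * Real.log M - z * Real.log z) := by
    intro z
    rw [Real.logb]
    rcases eq_or_ne z 0 with rfl | hz
    · simp
    · rw [Real.log_mul (by positivity) hz, one_div, Real.log_inv]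
      field_simp
      ring
  have hbits : ∀ g : ZMod 2 → ℝ, ∑ b, g b = g 0 + g 1 := fun g => Fin.sum_univ_two g
  unfold shannonH
  rw [Finset.mul_sum, Fintype.sum_prod_type]
  simp only [hterm, hbits]
  have hr : ∀ r, (1 / M) * (q (r, 0) * Real.log M - q (r, 0) * Real.log (q (r, 0)))
      + (1 / M) * (q (r, 1) * Real.log M - q (r, 1) * Real.log (q (r, 1)))
      = (1 / M) * (Real.log M + Real.log 2) - (1 / M) * (q (r, 0) * Real.log (q (r, 0))
        + q (r, 1) * Real.log (q (r, 1)) + Real.log 2) := by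
    intro r
    linear_combination (1 / M) * Real.log M * hq r
  simp only [hr]
  rw [Finset.sum_sub_distrib, Finset.sum_const, Finset.card_univ, nsmul_eq_mul, hcard, ← mul_assoc,
    mul_one_div_cancel hM.ne', one_mul, Finset.mul_sum]

lemma shannonH_uniform_pair_bounds {α : Type*} [Fintype α] {M : ℝ} (hM : 0 < M)
    (hcard : (Fintype.card α : ℝ) = M) (q : α × ZMod 2 → ℝ) (hq0 : ∀ p, 0 ≤ q p)
    (hq : ∀ r, q (r, 0) + q (r, 1) = 1) :
    Real.log M + Real.log 2 - (1 / M) * ∑ r, (q (r, 0) - q (r, 1)) ^ 2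
        ≤ Real.log 2 * shannonH (fun p => (1 / M) * q p) ∧
      Real.log 2 * shannonH (fun p => (1 / M) * q p)
        ≤ Real.log M + Real.log 2 - (1 / M) * ((∑ r, (q (r, 0) - q (r, 1)) ^ 2) / 2) := by
  have hb := fun r => mul_log_add_mul_log_bounds (hq0 (r, 0)) (hq0 (r, 1)) (hq r)
  rw [shannonH_uniform_pair hM hcard q hq, Finset.sum_div]
  constructor
  · gcongr with r
    exact (hb r).2
  · gcongr with r
    exact (hb r).1

/-- Replacing the bit `⟨k,r⟩`, `k ← D`, by a uniform bit on a set of keys changes the entropy of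
`(r, b)` in terms of the collision probabilities of `D` before and after removing that set. -/
lemma le_shannonH_sub_shannonH {n : ℕ} (D : (Fin n → ZMod 2) → ℝ) (hD : IsDist D)
    (S : (Fin n → ZMod 2) → Prop) [DecidablePred S] :
    (∑ k, D k ^ 2) / 2 - ∑ k, (if S k then 0 else D k) ^ 2 ≤
      Real.log 2 * (shannonH (fun p : (Fin n → ZMod 2) × ZMod 2 => (1 / 2 ^ n) *
          ((∑ k, if S k then D k else 0) / 2
            + ∑ k, if ¬ S k ∧ ip k p.1 = p.2 then D k else 0))
        - shannonH (fun p : (Fin n → ZMod 2) × ZMod 2 =>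
            (1 / 2 ^ n) * ∑ k, if ip k p.1 = p.2 then D k else 0)) := by
  obtain ⟨hD0, hD1⟩ := hD
  have hM : (0 : ℝ) < 2 ^ n := by positivity
  have hcard : (Fintype.card (Fin n → ZMod 2) : ℝ) = 2 ^ n := by simp
  let w : (Fin n → ZMod 2) → ℝ := fun k => if S k then 0 else D k
  have hw0 : ∀ k, 0 ≤ w k := fun k => by
    simp only [w]; split_ifs <;> simp [hD0]
  have hw : ∀ r b, (∑ k, if ¬ S k ∧ ip k r = b then D k else 0)
      = ∑ k, if ip k r = b then w k else 0 := by
    intro r b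
    refine Finset.sum_congr rfl fun k _ => ?_
    by_cases h1 : S k <;> by_cases h2 : ip k r = b <;> simp [w, h1, h2]
  have hsplit : (∑ k, if S k then D k else 0) + ∑ k, w k = 1 := by
    rw [← hD1, ← Finset.sum_add_distrib]
    refine Finset.sum_congr rfl fun k _ => ?_
    by_cases h1 : S k <;> simp [w, h1]
  have hS0 : 0 ≤ ∑ k, if S k then D k else 0 :=
    Finset.sum_nonneg fun k _ => by split_ifs <;> simp [hD0]
  have hP := (shannonH_uniform_pair_bounds hM hcard
    (fun p : (Fin n → ZMod 2) × ZMod 2 => (∑ k, if S k then D k else 0) / 2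
      + ∑ k, if ip k p.1 = p.2 then w k else 0)
    (fun p => add_nonneg (by positivity)
      (Finset.sum_nonneg fun k _ => by split_ifs <;> simp [hw0]))
    (fun r => by have := sum_ip_eq_add w r; dsimp only; linarith)).1
  have hQ := (shannonH_uniform_pair_bounds hM hcard
    (fun p : (Fin n → ZMod 2) × ZMod 2 => ∑ k, if ip k p.1 = p.2 then D k else 0)
    (fun p => Finset.sum_nonneg fun k _ => by split_ifs <;> simp [hD0])
    (fun r => (sum_ip_eq_add D r).trans hD1)).2
  simp only [add_sub_add_left_eq_sub, sum_ip_eq_sub, sum_sq_walsh] at hP hQ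
  simp only [hw]
  have e1 : 1 / (2 : ℝ) ^ n * (2 ^ n * ∑ k, w k ^ 2) = ∑ k, w k ^ 2 := by field_simp
  have e2 : 1 / (2 : ℝ) ^ n * (2 ^ n * (∑ k, D k ^ 2) / 2) = (∑ k, D k ^ 2) / 2 := by field_simp
  rw [e1] at hP
  rw [e2] at hQ
  rw [mul_sub]
  linarith

lemma isDist_condDist {S Y : Type*} [Fintype S] [DecidableEq Y] {K : S → ℝ}
    (hK : ∀ k, 0 ≤ K k) (f : S → Y) (y : Y) (hy : 0 < ∑ k, if f k = y then K k else 0) :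
    IsDist (condDist K f y) := by
  refine ⟨fun k => div_nonneg (by split_ifs <;> simp [hK]) hy.le, ?_⟩
  simp only [condDist]
  rw [← Finset.sum_div, div_self hy.ne']

/- Here `G = {k : 2^{-(j+1)} ≤ K k ≤ 2^{-j}}` and `A = {k : K k ≥ 2^{-j}·n^{-500}}`.
`(R,Q)` is the distribution of `(r, ⟨k,r⟩)` for independent `r ← U_n`, `k ← K_y`;
`(R,P)` is the distribution of `(r, b)` where `b` is a uniform independent bit if `k ∈ G`
and `b = ⟨k,r⟩` otherwise. -/
theorem stmt12 :
    ∃ N : ℕ, ∀ n : ℕ, N ≤ n →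
      ∀ K : (Fin n → ZMod 2) → ℝ, IsDist K →
      ∀ j : ℤ,
      ∀ (Y : Type) [Fintype Y] [DecidableEq Y],
      ∀ f : (Fin n → ZMod 2) → Y, ∀ y : Y,
        -- Pr_{k←K}[f(k) = y] > 0
        (0 < ∑ k, if f k = y then K k else 0) →
        -- Pr_{k←K}[k ∈ G | f(k) = y] ≥ 1/(6n)
        (1 / (6 * (n : ℝ)) ≤
          ∑ k, if (2 : ℝ) ^ (-(j + 1)) ≤ K k ∧ K k ≤ (2 : ℝ) ^ (-j)
               then condDist K f y k else 0) →
        -- at most one `k ∈ A` satisfies `f k = y`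
        (∀ k1 k2 : Fin n → ZMod 2,
          (2 : ℝ) ^ (-j) / (n : ℝ) ^ 500 ≤ K k1 → f k1 = y →
          (2 : ℝ) ^ (-j) / (n : ℝ) ^ 500 ≤ K k2 → f k2 = y →
          k1 = k2) →
        shannonH (fun p : (Fin n → ZMod 2) × ZMod 2 =>
              (1 / 2 ^ n) *
                ((∑ k, if (2 : ℝ) ^ (-(j + 1)) ≤ K k ∧ K k ≤ (2 : ℝ) ^ (-j)
                       then condDist K f y k else 0) / 2
                  + ∑ k, if ¬((2 : ℝ) ^ (-(j + 1)) ≤ K k ∧ K k ≤ (2 : ℝ) ^ (-j))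
                            ∧ ip k p.1 = p.2
                         then condDist K f y k else 0))
          - shannonH (fun p : (Fin n → ZMod 2) × ZMod 2 =>
              (1 / 2 ^ n) * ∑ k, if ip k p.1 = p.2 then condDist K f y k else 0)
          ≥ 1 / (100 * (n : ℝ) ^ 2) := by
  refine ⟨10, fun n hn K hK j Y _ _ f y hy hG hA => ?_⟩
  have hn' : (10 : ℝ) ≤ n := by exact_mod_cast hn
  set D := condDist K f y with hDdef
  have hD : IsDist D := isDist_condDist hK.1 f y hy
  have hmain := le_shannonH_sub_shannonH D hD
    (fun k => (2 : ℝ) ^ (-(j + 1)) ≤ K k ∧ K k ≤ (2 : ℝ) ^ (-j))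
  have hDne : ∀ k, D k ≠ 0 → f k = y := by
    intro k hk
    by_contra h
    exact hk (by simp [hDdef, condDist, h])
  have hpow : (10 : ℝ) ^ 4 * n ≤ (n : ℝ) ^ 500 := by
    calc (10 : ℝ) ^ 4 * n ≤ (n : ℝ) ^ 4 * n := by gcongr
      _ = (n : ℝ) ^ 5 := by ring
      _ ≤ (n : ℝ) ^ 500 := pow_le_pow_right₀ (by linarith) (by norm_num)
  have hj : (2 : ℝ) ^ (-(j + 1)) = (2 : ℝ) ^ (-j) / 2 := by
    rw [neg_add, zpow_add₀ two_ne_zero]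
    norm_num [div_eq_mul_inv]
  have hjpos : (0 : ℝ) < 2 ^ (-j) := by positivity
  have hn500 : (0 : ℝ) < (n : ℝ) ^ 500 := by positivity
  have hGA : ∀ k, (2 : ℝ) ^ (-(j + 1)) ≤ K k → (2 : ℝ) ^ (-j) / (n : ℝ) ^ 500 ≤ K k := by
    intro k hk
    refine le_trans ?_ hk
    rw [hj]
    gcongr
    linarith
  have hpos : (0 : ℝ) < 1 / (6 * (n : ℝ)) := by positivity
  obtain ⟨k₀, -, hk₀⟩ := Finset.exists_ne_zero_of_sum_ne_zero (hpos.trans_le hG).ne'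
  obtain ⟨hk₀G, hk₀D⟩ := ite_ne_right_iff.1 hk₀
  have hfk₀ := hDne k₀ hk₀D
  have huniq : ∀ k, f k = y → (2 : ℝ) ^ (-j) / (n : ℝ) ^ 500 ≤ K k → k = k₀ := fun k hk hkA =>
    hA k k₀ hkA hk (hGA k₀ hk₀G.1) hfk₀
  have hp : 1 / (6 * (n : ℝ)) ≤ D k₀ := by
    refine hG.trans_eq ?_
    rw [Finset.sum_eq_single k₀, if_pos hk₀G]
    · intro k _ hk
      rw [ite_eq_right_iff]
      intro hkG
      by_contra h
      exact hk (huniq k (hDne k h) (hGA k hkG.1))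
    · simp
  have hsq : D k₀ ^ 2 ≤ ∑ k, D k ^ 2 :=
    Finset.single_le_sum (f := fun k => D k ^ 2) (fun k _ => sq_nonneg _) (Finset.mem_univ k₀)
  have hsmall : ∀ k, k ≠ k₀ → D k ≤ 2 / (n : ℝ) ^ 500 * D k₀ := by
    intro k hk
    by_cases hfk : f k = y
    · have hkA : K k ≤ (2 : ℝ) ^ (-j) / (n : ℝ) ^ 500 := by
        by_contra! h
        exact hk (huniq k hfk h.le)
      simp only [hDdef, condDist, hfk, hfk₀, if_true]
      rw [← mul_div_assoc]
      gcongr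
      refine hkA.trans ?_
      have := hk₀G.1
      rw [hj] at this
      rw [div_mul_eq_mul_div]
      gcongr
      linarith
    · have h0 : D k = 0 := by simp [hDdef, condDist, hfk]
      rw [h0]
      exact mul_nonneg (by positivity) (hD.1 k₀)
  have hrest : ∑ k, (if (2 : ℝ) ^ (-(j + 1)) ≤ K k ∧ K k ≤ (2 : ℝ) ^ (-j) then 0 else D k) ^ 2
      ≤ 2 / (n : ℝ) ^ 500 * D k₀ := by
    calc _ ≤ ∑ k, 2 / (n : ℝ) ^ 500 * D k₀ * D k := by
          refine Finset.sum_le_sum fun k _ => ?_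
          have h0 := hD.1 k
          have h0' := hD.1 k₀
          split_ifs with h
          · rw [zero_pow two_ne_zero]
            positivity
          · rw [sq]
            exact mul_le_mul_of_nonneg_right
              (hsmall k fun hk => h (by rw [hk]; exact hk₀G)) h0
      _ = _ := by rw [← Finset.mul_sum, hD.2, mul_one]
  have hδ : 2 / (n : ℝ) ^ 500 ≤ 1 / 1000 * (1 / n) := by
    rw [div_le_iff₀ hn500]
    calc (2 : ℝ) ≤ 1 / 1000 * (1 / n) * (10 ^ 4 * n) := by
          field_simp
          norm_num
      _ ≤ _ := by gcongr
  set u : ℝ := 1 / n with hu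
  have hupos : 0 < u := by positivity
  have hp' : u / 6 ≤ D k₀ := by
    refine le_trans (le_of_eq ?_) hp
    rw [hu]
    field_simp
  have hgoal : 1 / (100 * (n : ℝ) ^ 2) = u ^ 2 / 100 := by
    rw [hu]
    field_simp
  have hL := Real.log_two_lt_d9
  refine ge_iff_le.2 (le_of_mul_le_mul_left (le_trans ?_ hmain) (Real.log_pos one_lt_two))
  rw [hgoal]
  have h1 : 2 / (n : ℝ) ^ 500 * D k₀ ≤ 1 / 1000 * u * D k₀ :=
    mul_le_mul_of_nonneg_right hδ (hD.1 k₀)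
  have h2 : Real.log 2 * (u ^ 2 / 100) ≤ 7 / 10 * (u ^ 2 / 100) := by
    gcongr
    linarith
  nlinarith
end
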